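/- Let K be a field, B an associative (possibly non-unital) K-algebra, (I, ≤) a directed preordered set, and (e_i)_{i∈I} a family of idempotents of B such that e_i·e_j = e_j·e_i = e_i whenever i ≤ j, and such that every element of B lies in some corner e_i·B·e_i := {e_i·b·e_i : b ∈ B}. Suppose that for every i ∈ I, every centralizer of the corner algebra e_i·B·e_i is of the form k·id for some k ∈ K. Then every centralizer of B is of the form k·id_B for some k ∈ K; in particular the centroid 𝒞(B) is isomorphic to K as a K-algebra. -/

import Mathlib

/-- A centralizer of a (possibly non-unital) associative `K`-algebra `A`. -/
def IsCentralizer {K A : Type*} [Field K] [NonUnitalRing A] [Module K A]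
    (τ : A →ₗ[K] A) : Prop :=
  ∀ x y : A, τ (x * y) = τ x * y ∧ τ (x * y) = x * τ y

/-- A centralizer of the corner algebra `eAe`, encoded as the `K`-linear map on `A`
obtained by extending through the canonical compression `x ↦ e * x * e`. -/
def IsCornerCentralizer {K A : Type*} [Field K] [NonUnitalRing A] [Module K A]
    (e : A) (T : A →ₗ[K] A) : Prop :=
  (∀ x : A, e * T x * e = T x) ∧
  (∀ x : A, T (e * x * e) = T x) ∧
  (∀ x y : A, e * x * e = x → e * y * e = y →
    T (x * y) = T x * y ∧ T (x * y) = x * T y)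

/-- Compressing a centralizer of `A` to the corner of an idempotent `e` gives a centralizer
of that corner. -/
theorem IsCentralizer.isCornerCentralizer_comp {K A : Type*} [Field K] [NonUnitalRing A]
    [Module K A] [SMulCommClass K A A] [IsScalarTower K A A] {τ : A →ₗ[K] A}
    (hτ : IsCentralizer τ) {e : A} (he : IsIdempotentElem e) :
    IsCornerCentralizer e
      (τ ∘ₗ LinearMap.mulRight K e ∘ₗ LinearMap.mulLeft K e) := by
  have hcompress (x : A) : e * (e * x * e) * e = e * x * e := by
    simp only [mul_assoc, he.eq]
    simp only [← mul_assoc, he.eq]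
  refine ⟨fun x => ?_, fun x => ?_, fun x y hx hy => ?_⟩ <;>
    simp only [LinearMap.comp_apply, LinearMap.mulLeft_apply, LinearMap.mulRight_apply]
  · rw [← (hτ _ _).2, ← (hτ _ _).1, hcompress]
  · rw [hcompress]
  · have hex : e * x = x := by
      rw [← hx]
      simp only [← mul_assoc, he.eq]
    have hye : y * e = y := by
      rw [← hy]
      simp only [mul_assoc, he.eq]
    have hxy : e * (x * y) * e = x * y := by
      rw [← mul_assoc, hex, mul_assoc, hye]
    rw [hxy, hx, hy]
    exact hτ x y

/-- A larger idempotent has a larger corner. -/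
theorem corner_mem_of_le {A : Type*} [NonUnitalRing A] {e f x : A}
    (hef : e * f = e) (hfe : f * e = e) (hx : e * x * e = x) : f * x * f = x := by
  rw [← hx]
  simp only [mul_assoc, hef]
  simp only [← mul_assoc, hfe]

/-- Let `B` be a (possibly non-unital) associative `K`-algebra which is the directed
union of the corners `e i · B · e i` of a compatible directed family of idempotents
`(e i)`.  If every centralizer of each corner algebra `e i · B · e i` is a scalar
multiple of the identity, then every centralizer of `B` is a scalar multiple of the
identity; in particular `𝒞(B) ≅ K`. -/
theorem centroid_eq_scalars_of_corners
    {K B : Type*} [Field K] [NonUnitalRing B] [Module K B]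
    [SMulCommClass K B B] [IsScalarTower K B B]
    {I : Type*} [Preorder I]
    (hdir : ∀ i j : I, ∃ k : I, i ≤ k ∧ j ≤ k)
    (e : I → B)
    (hidem : ∀ i, e i * e i = e i)
    (hle : ∀ i j, i ≤ j → e i * e j = e i ∧ e j * e i = e i)
    (hcover : ∀ x : B, ∃ i, e i * x * e i = x)
    (hcorner : ∀ (i : I) (T : B →ₗ[K] B), IsCornerCentralizer (e i) T →
      ∃ k : K, ∀ x : B, e i * x * e i = x → T x = k • x) :
    ∀ τ : B →ₗ[K] B, IsCentralizer τ →
      ∃ k : K, τ = k • (LinearMap.id : B →ₗ[K] B) := by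
  intro τ hτ
  have hscalar (i : I) : ∃ k : K, ∀ x : B, e i * x * e i = x → τ x = k • x := by
    obtain ⟨k, hk⟩ := hcorner i _ (hτ.isCornerCentralizer_comp (hidem i))
    refine ⟨k, fun x hx => ?_⟩
    simpa [hx] using hk x hx
  choose k hk using hscalar
  by_cases hzero : ∀ i, e i = 0
  · refine ⟨0, LinearMap.ext fun x => ?_⟩
    obtain ⟨i, hx⟩ := hcover x
    have hx0 : x = 0 := by rw [← hx, hzero i, mul_zero]
    simp [hx0]
  · push Not at hzero
    obtain ⟨i₀, hi₀⟩ := hzero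
    refine ⟨k i₀, LinearMap.ext fun x => ?_⟩
    obtain ⟨i, hx⟩ := hcover x
    obtain ⟨j, hij, hi₀j⟩ := hdir i i₀
    have he : e i₀ * e i₀ * e i₀ = e i₀ := by rw [hidem, hidem]
    have hkj : k j = k i₀ := by
      apply smul_left_injective K hi₀
      change k j • e i₀ = k i₀ • e i₀
      rw [← hk i₀ _ he, hk j _ (corner_mem_of_le (hle _ _ hi₀j).1 (hle _ _ hi₀j).2 he)]
    rw [hk j x (corner_mem_of_le (hle _ _ hij).1 (hle _ _ hij).2 hx), hkj]
    rfl
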